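/- Let n ≥ 1, let A be an n×n matrix and b an n-vector with entries in ℝ ∪ {-∞}, and define the Kleene star A* = I ⊕ A ⊕ A^⊗2 ⊕ ⋯ ⊕ A^⊗(n-1) (entrywise maximum of max-plus powers). If Tr(A) := max_{1≤p≤n} tr(A^⊗p) < 0, then the vector x = A* ⊗ b satisfies A ⊗ x ⊕ b = x (that is, max(max_k (A_{ik} + x_k), b_i) = x_i for every index i), and moreover every regular vector x (i.e., with all entries ≠ -∞) satisfying A ⊗ x ⊕ b = x equals A* ⊗ b. -/

import Mathlib

/- Max-plus algebra over `ℝ ∪ {-∞}`, modelled as `WithBot ℝ`: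
addition is `max` (`⊔`, with bottom `⊥ = -∞`) and multiplication is `+`
(where `⊥ + x = x + ⊥ = ⊥`). -/

/-- Max-plus product of matrices over `ℝ ∪ {-∞}`. -/
noncomputable def mpMul {n : ℕ} (A B : Fin n → Fin n → WithBot ℝ) :
    Fin n → Fin n → WithBot ℝ :=
  fun i j => Finset.univ.sup fun k => A i k + B k j

/-- Max-plus identity matrix: `0` on the diagonal, `-∞` off the diagonal. -/
noncomputable def mpId {n : ℕ} : Fin n → Fin n → WithBot ℝ :=
  fun i j => if i = j then (0 : WithBot ℝ) else ⊥

/-- Max-plus matrix power, `A^⊗0 = I`. -/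
noncomputable def mpPow {n : ℕ} (A : Fin n → Fin n → WithBot ℝ) :
    ℕ → Fin n → Fin n → WithBot ℝ
  | 0 => mpId
  | p + 1 => mpMul A (mpPow A p)

/-- Max-plus trace: maximum diagonal entry. -/
noncomputable def mpTr {n : ℕ} (A : Fin n → Fin n → WithBot ℝ) : WithBot ℝ :=
  Finset.univ.sup fun i => A i i

/-- `Tr(A) = max_{1 ≤ p ≤ n} tr(A^⊗p)`, the tropical analogue of the determinant. -/
noncomputable def mpTrStar {n : ℕ} (A : Fin n → Fin n → WithBot ℝ) : WithBot ℝ :=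
  (Finset.Icc 1 n).sup fun p => mpTr (mpPow A p)

/-- Kleene star: `A* = I ⊕ A ⊕ A^⊗2 ⊕ ⋯ ⊕ A^⊗(n-1)` (entrywise maximum). -/
noncomputable def mpStar {n : ℕ} (A : Fin n → Fin n → WithBot ℝ) :
    Fin n → Fin n → WithBot ℝ :=
  fun i j => (Finset.range n).sup fun p => mpPow A p i j

/-- Max-plus matrix-vector product: `(A ⊗ x) i = max_k (A i k + x k)`. -/
noncomputable def mpMulVec {n : ℕ} (A : Fin n → Fin n → WithBot ℝ)
    (x : Fin n → WithBot ℝ) : Fin n → WithBot ℝ :=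
  fun i => Finset.univ.sup fun k => A i k + x k

theorem le_mpMul {n : ℕ} (A B : Fin n → Fin n → WithBot ℝ) (i k j : Fin n) :
    A i k + B k j ≤ mpMul A B i j :=
  Finset.le_sup (f := fun k => A i k + B k j) (Finset.mem_univ k)

theorem exists_eq_mpMul {n : ℕ} (A B : Fin n → Fin n → WithBot ℝ) (i j : Fin n) :
    ∃ k, mpMul A B i j = A i k + B k j := by
  obtain ⟨k, -, hk⟩ := Finset.exists_mem_eq_sup Finset.univ ⟨i, Finset.mem_univ i⟩
    (fun k => A i k + B k j)
  exact ⟨k, hk⟩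

theorem le_mpMulVec {n : ℕ} (A : Fin n → Fin n → WithBot ℝ) (x : Fin n → WithBot ℝ)
    (i k : Fin n) : A i k + x k ≤ mpMulVec A x i :=
  Finset.le_sup (f := fun k => A i k + x k) (Finset.mem_univ k)

theorem exists_eq_mpMulVec {n : ℕ} (A : Fin n → Fin n → WithBot ℝ) (x : Fin n → WithBot ℝ)
    (i : Fin n) : ∃ k, mpMulVec A x i = A i k + x k := by
  obtain ⟨k, -, hk⟩ := Finset.exists_mem_eq_sup Finset.univ ⟨i, Finset.mem_univ i⟩
    (fun k => A i k + x k)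
  exact ⟨k, hk⟩

theorem mpPow_le_mpStar_of_lt {n : ℕ} (A : Fin n → Fin n → WithBot ℝ) {p : ℕ} (hp : p < n)
    (i j : Fin n) : mpPow A p i j ≤ mpStar A i j :=
  Finset.le_sup (f := fun p => mpPow A p i j) (Finset.mem_range.2 hp)

theorem exists_eq_mpStar {n : ℕ} (A : Fin n → Fin n → WithBot ℝ) (i j : Fin n) :
    ∃ p < n, mpStar A i j = mpPow A p i j := by
  obtain ⟨p, hp, h⟩ := Finset.exists_mem_eq_sup (Finset.range n)
    ⟨0, Finset.mem_range.2 i.pos⟩ (fun p => mpPow A p i j)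
  exact ⟨p, Finset.mem_range.1 hp, h⟩

theorem mpPow_diag_lt_zero {n : ℕ} {A : Fin n → Fin n → WithBot ℝ} (hTr : mpTrStar A < 0)
    {p : ℕ} (hp : 1 ≤ p) (hpn : p ≤ n) (i : Fin n) : mpPow A p i i < 0 :=
  calc mpPow A p i i ≤ mpTr (mpPow A p) :=
        Finset.le_sup (f := fun i => mpPow A p i i) (Finset.mem_univ i)
    _ ≤ mpTrStar A :=
        Finset.le_sup (f := fun p => mpTr (mpPow A p)) (Finset.mem_Icc.2 ⟨hp, hpn⟩)
    _ < 0 := hTr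

theorem mpPow_zero_add_le {n : ℕ} (A : Fin n → Fin n → WithBot ℝ) (y : Fin n → WithBot ℝ)
    (i k : Fin n) : mpPow A 0 i k + y k ≤ y i := by
  by_cases h : i = k
  · simp [mpPow, mpId, h]
  · simp [mpPow, mpId, h]

theorem mpPow_add_mpPow_le {n : ℕ} (A : Fin n → Fin n → WithBot ℝ) (p q : ℕ)
    (i k j : Fin n) : mpPow A p i k + mpPow A q k j ≤ mpPow A (p + q) i j := by
  induction p generalizing i with
  | zero => simpa using mpPow_zero_add_le A (fun i => mpPow A q i j) i k
  | succ p ih =>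
    obtain ⟨l, hl⟩ := exists_eq_mpMul A (mpPow A p) i k
    rw [Nat.add_right_comm p 1 q]
    calc mpPow A (p + 1) i k + mpPow A q k j
        = A i l + (mpPow A p l k + mpPow A q k j) := by rw [← add_assoc, ← hl]; rfl
      _ ≤ A i l + mpPow A (p + q) l j := by gcongr; exact ih l
      _ ≤ mpPow A (p + q + 1) i j := le_mpMul A (mpPow A (p + q)) i l j

/-- A potential `u` along a walk `w` that drops by at most the edge weights drops in total
by at most the corresponding entry of the matrix power. -/
theorem le_mpPow_add_of_step {n : ℕ} (A : Fin n → Fin n → WithBot ℝ) (w : ℕ → Fin n)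
    (u : ℕ → WithBot ℝ) (p s : ℕ)
    (h : ∀ k, s ≤ k → k < s + p → u k ≤ A (w k) (w (k + 1)) + u (k + 1)) :
    u s ≤ mpPow A p (w s) (w (s + p)) + u (s + p) := by
  induction p generalizing s with
  | zero => simp [mpPow, mpId]
  | succ p ih =>
    have h' := ih (s + 1) fun k hk hk' => h k (by omega) (by omega)
    rw [show s + 1 + p = s + (p + 1) by omega] at h'
    calc u s ≤ A (w s) (w (s + 1)) + u (s + 1) := h s le_rfl (by omega)
      _ ≤ A (w s) (w (s + 1)) + (mpPow A p (w (s + 1)) (w (s + (p + 1))) + u (s + (p + 1))) := by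
        gcongr
      _ ≤ mpPow A (p + 1) (w s) (w (s + (p + 1))) + u (s + (p + 1)) := by
        rw [← add_assoc]
        gcongr
        exact le_mpMul A (mpPow A p) _ _ _

theorem exists_lt_le_apply_eq {n : ℕ} (w : ℕ → Fin n) : ∃ s t, s < t ∧ t ≤ n ∧ w s = w t := by
  obtain ⟨s, t, hst, h⟩ := Fintype.exists_ne_map_eq_of_card_lt
    (fun k : Fin (n + 1) => w k) (by simp)
  rcases lt_or_gt_of_ne hst with hlt | hlt
  · exact ⟨s, t, hlt, by omega, h⟩
  · exact ⟨t, s, hlt, by omega, h.symm⟩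

theorem exists_lt_mpPow_le {n : ℕ} {A : Fin n → Fin n → WithBot ℝ} (hTr : mpTrStar A < 0)
    {p : ℕ} (hp : n ≤ p) (i j : Fin n) : ∃ q < p, mpPow A p i j ≤ mpPow A q i j := by
  choose g hg using fun (q : ℕ) (v : Fin n) => exists_eq_mpMul A (mpPow A q) v j
  let w : ℕ → Fin n := fun k => Nat.rec i (fun k v => g (p - (k + 1)) v) k
  let u : ℕ → WithBot ℝ := fun k => mpPow A (p - k) (w k) j
  have hu : ∀ k < p, u k ≤ A (w k) (w (k + 1)) + u (k + 1) := by
    intro k hk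
    have h := hg (p - (k + 1)) (w k)
    change mpPow A (p - (k + 1) + 1) (w k) j = _ at h
    rw [show p - (k + 1) + 1 = p - k by omega] at h
    exact h.le
  obtain ⟨s, t, hst, htn, hw⟩ := exists_lt_le_apply_eq w
  have h₁ := le_mpPow_add_of_step A w u s 0 fun k _ hk => hu k (by omega)
  have h₂ := le_mpPow_add_of_step A w u (t - s) s fun k _ hk => hu k (by omega)
  rw [show s + (t - s) = t by omega, ← hw] at h₂
  rw [Nat.zero_add] at h₁
  refine ⟨s + (p - t), by omega, ?_⟩
  calc mpPow A p i j ≤ mpPow A s i (w s) + u s := h₁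
    _ ≤ mpPow A s i (w s) + (0 + u t) := by
      gcongr
      exact h₂.trans (by gcongr; exact (mpPow_diag_lt_zero hTr (by omega) (by omega) _).le)
    _ = mpPow A s i (w s) + mpPow A (p - t) (w s) j := by rw [zero_add, hw]
    _ ≤ mpPow A (s + (p - t)) i j := mpPow_add_mpPow_le A _ _ _ _ _

theorem mpPow_le_mpStar {n : ℕ} {A : Fin n → Fin n → WithBot ℝ} (hTr : mpTrStar A < 0)
    (p : ℕ) (i j : Fin n) : mpPow A p i j ≤ mpStar A i j := by
  induction p using Nat.strong_induction_on with
  | _ p ih =>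
    rcases lt_or_ge p n with hp | hp
    · exact mpPow_le_mpStar_of_lt A hp i j
    · obtain ⟨q, hq, h⟩ := exists_lt_mpPow_le hTr hp i j
      exact h.trans (ih q hq)

theorem mpStar_mulVec_isFixed {n : ℕ} {A : Fin n → Fin n → WithBot ℝ} (hTr : mpTrStar A < 0)
    (b : Fin n → WithBot ℝ) (i : Fin n) :
    mpMulVec A (mpMulVec (mpStar A) b) i ⊔ b i = mpMulVec (mpStar A) b i := by
  apply le_antisymm
  · apply sup_le
    · obtain ⟨k, hk⟩ := exists_eq_mpMulVec A (mpMulVec (mpStar A) b) i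
      obtain ⟨l, hl⟩ := exists_eq_mpMulVec (mpStar A) b k
      obtain ⟨q, -, hq⟩ := exists_eq_mpStar A k l
      rw [hk, hl, hq, ← add_assoc]
      refine le_trans ?_ (le_mpMulVec (mpStar A) b i l)
      gcongr
      exact (le_mpMul A (mpPow A q) i k l).trans (mpPow_le_mpStar hTr (q + 1) i l)
    · refine le_trans ?_ (le_mpMulVec (mpStar A) b i i)
      have h := mpPow_le_mpStar_of_lt A i.pos i i
      calc b i = mpPow A 0 i i + b i := by simp [mpPow, mpId]
        _ ≤ mpStar A i i + b i := by gcongr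
  · obtain ⟨l, hl⟩ := exists_eq_mpMulVec (mpStar A) b i
    obtain ⟨q, hqn, hq⟩ := exists_eq_mpStar A i l
    rw [hl, hq]
    cases q with
    | zero => exact (mpPow_zero_add_le A b i l).trans le_sup_right
    | succ q =>
      obtain ⟨k, hk⟩ := exists_eq_mpMul A (mpPow A q) i l
      change mpMul A (mpPow A q) i l + b l ≤ _
      rw [hk, add_assoc]
      refine le_trans ?_ ((le_mpMulVec A (mpMulVec (mpStar A) b) i k).trans le_sup_left)
      gcongr
      refine le_trans ?_ (le_mpMulVec (mpStar A) b k l)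
      gcongr
      exact mpPow_le_mpStar_of_lt A (by omega) k l

theorem mpPow_add_le_of_isFixed {n : ℕ} {A : Fin n → Fin n → WithBot ℝ}
    {b x : Fin n → WithBot ℝ} (hx : ∀ i, mpMulVec A x i ⊔ b i = x i) (q : ℕ) (i l : Fin n) :
    mpPow A q i l + b l ≤ x i := by
  induction q generalizing i with
  | zero => exact (mpPow_zero_add_le A b i l).trans (le_sup_right.trans (hx i).le)
  | succ q ih =>
    obtain ⟨k, hk⟩ := exists_eq_mpMul A (mpPow A q) i l
    calc mpPow A (q + 1) i l + b l = A i k + (mpPow A q k l + b l) := by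
          rw [← add_assoc, ← hk]; rfl
      _ ≤ A i k + x k := by gcongr; exact ih k
      _ ≤ x i := (le_mpMulVec A x i k).trans (le_sup_left.trans (hx i).le)

theorem le_mpStar_mulVec_of_isFixed {n : ℕ} {A : Fin n → Fin n → WithBot ℝ}
    (hTr : mpTrStar A < 0) {b x : Fin n → WithBot ℝ} (hreg : ∀ i, x i ≠ ⊥)
    (hx : ∀ i, mpMulVec A x i ⊔ b i = x i) (i : Fin n) : x i ≤ mpMulVec (mpStar A) b i := by
  choose f hf using exists_eq_mpMulVec A x
  have hstep : ∀ v, x v ≠ b v → x v ≤ A v (f v) + x (f v) := by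
    intro v hv
    rcases max_choice (mpMulVec A x v) (b v) with h | h
    · exact ((hx v).symm.trans (h.trans (hf v))).le
    · exact absurd ((hx v).symm.trans h) hv
  let w : ℕ → Fin n := fun k => f^[k] i
  have hw : ∀ k, w (k + 1) = f (w k) := fun k => Function.iterate_succ_apply' f k i
  have hstep' : ∀ k, x (w k) ≠ b (w k) →
      x (w k) ≤ A (w k) (w (k + 1)) + x (w (k + 1)) := by
    intro k hk
    rw [hw]
    exact hstep _ hk
  classical
  by_cases hex : ∃ k, x (w k) = b (w k)
  · have hmin : ∀ k < Nat.find hex, x (w k) ≠ b (w k) := fun k hk => Nat.find_min hex hk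
    have h := le_mpPow_add_of_step A w (fun k => x (w k)) (Nat.find hex) 0
      fun k _ hk => hstep' k (hmin k (by omega))
    rw [Nat.zero_add] at h
    calc x i ≤ mpPow A (Nat.find hex) i (w (Nat.find hex)) + x (w (Nat.find hex)) := h
      _ ≤ mpStar A i (w (Nat.find hex)) + b (w (Nat.find hex)) := by
        rw [Nat.find_spec hex]
        gcongr
        exact mpPow_le_mpStar hTr _ _ _
      _ ≤ mpMulVec (mpStar A) b i := le_mpMulVec _ _ _ _
  · push Not at hex
    obtain ⟨s, t, hst, htn, hwst⟩ := exists_lt_le_apply_eq w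
    have h := le_mpPow_add_of_step A w (fun k => x (w k)) (t - s) s
      fun k _ _ => hstep' k (hex k)
    rw [show s + (t - s) = t by omega, ← hwst] at h
    have hneg := mpPow_diag_lt_zero hTr (p := t - s) (by omega) (by omega) (w s)
    have hlt := WithBot.add_lt_add_right (hreg (w s)) hneg
    rw [zero_add] at hlt
    exact absurd h hlt.not_ge

/-- Let `n ≥ 1`, `A` an `n×n` matrix and `b` an `n`-vector over `ℝ ∪ {-∞}`.
If `Tr(A) = max_{1≤p≤n} tr(A^⊗p) < 0`, then `x = A* ⊗ b` satisfies `A ⊗ x ⊕ b = x`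
(i.e. `max(max_k (A i k + x k), b i) = x i` for every `i`), and every regular vector `x`
(all entries `≠ -∞`) satisfying `A ⊗ x ⊕ b = x` equals `A* ⊗ b`. -/
theorem stmt_0 {n : ℕ} (hn : 1 ≤ n) (A : Fin n → Fin n → WithBot ℝ)
    (b : Fin n → WithBot ℝ) (hTr : mpTrStar A < 0) :
    (∀ i, mpMulVec A (mpMulVec (mpStar A) b) i ⊔ b i = mpMulVec (mpStar A) b i) ∧
    (∀ x : Fin n → WithBot ℝ, (∀ i, x i ≠ ⊥) →
      (∀ i, mpMulVec A x i ⊔ b i = x i) → x = mpMulVec (mpStar A) b) := by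
  refine ⟨mpStar_mulVec_isFixed hTr b, fun x hreg hx => funext fun i => le_antisymm
    (le_mpStar_mulVec_of_isFixed hTr hreg hx i) ?_⟩
  obtain ⟨l, hl⟩ := exists_eq_mpMulVec (mpStar A) b i
  obtain ⟨q, -, hq⟩ := exists_eq_mpStar A i l
  rw [hl, hq]
  exact mpPow_add_le_of_isFixed hx q i l
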